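/- In Rado's busy beaver model, every Turing machine with 2 states and 3 symbols that halts when started in state A on the all-blank tape performs at most 38 steps and leaves at most 9 non-blank cells, and both bounds are attained by some such machine; that is, S(2,3) = 38 and Σ(2,3) = 9. -/

import Mathlib

/-- Move direction of the tape head. -/
inductive Dir : Type
  | L
  | R

/-- The head displacement of a direction. -/
def Dir.move : Dir → ℤ
  | Dir.L => -1
  | Dir.R => 1

/-- A Turing machine with `n` states and `k` symbols, in Rado's busy beaver model.
States are `Fin n` (state `A` is `0`, `B` is `1`, ...), symbols are `Fin k` with `0`
the blank symbol. A transition yields the written symbol, the move direction and the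
next state, where `none` denotes the halting state `H`. -/
abbrev Machine (n k : ℕ) : Type :=
  Fin n → Fin k → Fin k × Dir × Option (Fin n)

/-- A configuration: current state (`none` = halted), head position, tape. -/
structure Cfg (n k : ℕ) where
  state : Option (Fin n)
  pos : ℤ
  tape : ℤ → Fin k

/-- One computation step (halted configurations are fixed). -/
def step {n k : ℕ} (M : Machine n k) (c : Cfg n k) : Cfg n k :=
  match c.state with
  | none => c
  | some q =>
      { state := (M q (c.tape c.pos)).2.2
        pos := c.pos + (M q (c.tape c.pos)).2.1.move
        tape := Function.update c.tape c.pos (M q (c.tape c.pos)).1 }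

/-- The initial configuration: state `A`, head at cell `0`, all-blank tape. -/
def init (n k : ℕ) [NeZero k] : Cfg n k :=
  { state := if h : 0 < n then some ⟨0, h⟩ else none
    pos := 0
    tape := fun _ => 0 }

/-- `HaltsIn M c t`: started from `c`, the machine `M` halts after exactly `t` steps. -/
def HaltsIn {n k : ℕ} (M : Machine n k) (c : Cfg n k) (t : ℕ) : Prop :=
  ((step M)^[t] c).state = none ∧ ∀ i < t, ((step M)^[i] c).state ≠ none

/-- The number of non-blank cells of a configuration. -/
noncomputable def sigmaCount {n k : ℕ} [NeZero k] (c : Cfg n k) : ℕ :=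
  Set.ncard {i : ℤ | c.tape i ≠ 0}

/-- Rado's condition: every transition into the halting state writes `1` and moves right. -/
def Valid {n k : ℕ} [NeZero k] (M : Machine n k) : Prop :=
  ∀ q a, (M q a).2.2 = none → (M q a).1 = 1 ∧ (M q a).2.1 = Dir.R

/-- The busy beaver step function `S(n,k)`: the maximum number of steps of a halting
`n`-state `k`-symbol machine started on the all-blank tape. -/
noncomputable def bbS (n k : ℕ) [NeZero k] : ℕ :=
  sSup {t : ℕ | ∃ M : Machine n k, Valid M ∧ HaltsIn M (init n k) t}

/-- The busy beaver score function `Σ(n,k)`: the maximum number of non-blank cells left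
by a halting `n`-state `k`-symbol machine started on the all-blank tape. -/
noncomputable def bbSigma (n k : ℕ) [NeZero k] : ℕ :=
  sSup {m : ℕ | ∃ M : Machine n k, Valid M ∧
    ∃ t : ℕ, HaltsIn M (init n k) t ∧ sigmaCount ((step M)^[t] (init n k)) = m}

namespace BusyBeaver

/-! ### The checker

A table `T : ℕ` lists transitions in base 16: the digit `3 * q + a` is `0` when the transition of
state `q` at symbol `a` is not yet chosen, and `v + 1` with `v = 4 * w + 2 * d + q'` when it writes
`w`, moves right (`d = 0`) or left (`d = 1`) and enters `q'`. The search runs the machine on the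
blank tape, branching over all transitions whenever an unchosen one is needed. Machines still
running at the end must be shown not to halt, by finding finite sets of words and of local
configurations closed under the steps of the machine. Raw recursors keep kernel evaluation fast. -/

/-- Apply `f` to the evaluated number `n`. -/
def force {β : Type} (n : ℕ) (f : ℕ → β) : β :=
  @Nat.rec (fun _ => β) (f 0) (fun m _ => f m) (Nat.succ n)

local notation "test(" b ";" t ";" f ")" => @Bool.rec (fun _ => _) f t b

/-- The digit `i` of the table `T`. -/
def look (T i : ℕ) : ℕ := Nat.mod (Nat.div T (Nat.pow 16 i)) 16

/-- Membership in a list of numbers. -/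
def memN (x : ℕ) (l : List ℕ) : Bool :=
  @List.rec ℕ (fun _ => Bool) false (fun y _ ih => test(Nat.beq x y; true; ih)) l

/-- Whether all members of a list of numbers satisfy `f`. -/
def allN (f : ℕ → Bool) (l : List ℕ) : Bool :=
  @List.rec ℕ (fun _ => Bool) true (fun y _ ih => test(f y; ih; false)) l

/-- Fold over the members of a list that are congruent to `x` modulo `P`. -/
def exts {β : Type} (P x : ℕ) (f : ℕ → β → β) (b : β) (l : List ℕ) : β :=
  @List.rec ℕ (fun _ => β) b (fun g _ ih => test(Nat.beq (Nat.mod g P) x; f g ih; ih)) l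

/-- The local configuration with scanned symbol `s < B`, left word `l`, right word `r < P` and
state `q`. -/
def code (B P l r s q : ℕ) : ℕ :=
  Nat.add q (Nat.mul 2 (Nat.add s (Nat.mul B (Nat.add r (Nat.mul P l)))))

/-- The word `a` extended by the symbol that transition `v` at index `i` writes over `s`. Symbols
carry modulo 3 the actual symbol, and above it a hash of the transitions that last visited. -/
def push (K B i v s a : ℕ) : ℕ :=
  Nat.add (Nat.add (Nat.div v 4)
    (Nat.mul 3 (Nat.mod (Nat.add (Nat.succ i) (Nat.mul 7 (Nat.div s 3))) K))) (Nat.mul B a)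

/-- Continue with `k` after the transition `v`, which moves towards `r` and away from `l`. -/
def turn {β : Type} (K B : ℕ) (k : ℕ → ℕ → ℕ → β) (v i s l r : ℕ) : β :=
  force (Nat.mod v 2) (force r (force (push K B i v s l) k))

/-- Apply the transition at index `i` to a local configuration. -/
def stepK {β : Type} (K B T : ℕ) (fail : β) (right left : ℕ → ℕ → ℕ → β) (l r s i : ℕ) : β :=
  @Nat.rec (fun _ => β) fail
    (fun v _ => test(Nat.beq (Nat.mod (Nat.div v 2) 2) 0;
      turn K B right v i s l r; turn K B left v i s r l)) (look T i)

/-- Decode the remaining components of the local configuration `c` and apply a transition. -/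
def expand1 {β : Type} (K B P T : ℕ) (fail : β) (right left : ℕ → ℕ → ℕ → β) (c s lr : ℕ) : β :=
  force (Nat.add (Nat.mul 3 (Nat.mod c 2)) (Nat.mod s 3))
    (stepK K B T fail right left (Nat.div lr P) (Nat.mod lr P) s)

/-- Decode the local configuration `c` and apply a transition. -/
def expand {β : Type} (K B P T : ℕ) (fail : β) (right left : ℕ → ℕ → ℕ → β) (c : ℕ) : β :=
  force (Nat.div (Nat.div c 2) B)
    (force (Nat.mod (Nat.div c 2) B) (expand1 K B P T fail right left c))

/-- The local configuration after moving right, leaving the word `g` and facing the word `h`. -/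
def codeR (B P g q h : ℕ) : ℕ := code B P (Nat.mod g P) (Nat.div h B) (Nat.mod h B) q

/-- The local configuration after moving left, leaving the word `g` and facing the word `h`. -/
def codeL (B P g q h : ℕ) : ℕ := code B P (Nat.div h B) (Nat.mod g P) (Nat.mod h B) q

/-- `memN` with its arguments exchanged. -/
def memF (S : List ℕ) (d : ℕ) : Bool := memN d S

/-- All outcomes of a move that leaves the word `g` and faces a word extending `x` are listed. -/
def closedX (cd : ℕ → ℕ → ℕ → ℕ) (P : ℕ) (L R S : List ℕ) (g x q : ℕ) : Bool :=
  test(memN g L; exts P x (fun h ih => test(force (cd g q h) (memF S); ih; false)) true R; false)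

/-- The left words `L`, right words `R` and local configurations `S` include those of the blank
tape and are closed under the steps of the machine. -/
def closed (K B P T : ℕ) (L R S : List ℕ) : Bool :=
  test(memN 0 L; test(memN 0 R; test(memN 0 S;
    allN (expand K B P T false (closedX (codeR B P) P L R S) (closedX (codeL B P) P R L S)) S;
    false); false); false)

/-- Record the word `g` left behind, and schedule all outcomes of the move. -/
def add1 (cd : ℕ → ℕ → ℕ → ℕ) (P : ℕ) (L R : List ℕ) (k : Bool → List ℕ → List ℕ → Bool)
    (grew : Bool) (work : List ℕ) (g x q : ℕ) : Bool :=
  test(memN g L; k grew L; k true (g :: L))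
    (exts P x (fun h ih => force (cd g q h) (fun d => d :: ih)) work R)

/-- Continue a sweep after a move to the right. -/
def kR (ih : Bool → List ℕ → List ℕ → List ℕ → List ℕ → Bool) (R S : List ℕ) (grew : Bool)
    (L work : List ℕ) : Bool :=
  ih grew L R S work

/-- Continue a sweep after a move to the left. -/
def kL (ih : Bool → List ℕ → List ℕ → List ℕ → List ℕ → Bool) (L S : List ℕ) (grew : Bool)
    (R work : List ℕ) : Bool :=
  ih grew L R S work

/-- Process the scheduled local configuration `c`. -/
def visit (K B P T : ℕ) (ih : Bool → List ℕ → List ℕ → List ℕ → List ℕ → Bool)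
    (grew : Bool) (L R S : List ℕ) (c : ℕ) (work : List ℕ) : Bool :=
  test(memN c S; ih grew L R S work;
    expand K B P T false
      (add1 (codeR B P) P L R (kR ih R (c :: S)) grew work)
      (add1 (codeL B P) P R L (kL ih L (c :: S)) grew work) c)

/-- Process the next scheduled configuration; when none is left, start over with `k` if words were
added, and otherwise check the result. -/
def sweepS (K B P T : ℕ) (k : List ℕ → List ℕ → Bool)
    (ih : Bool → List ℕ → List ℕ → List ℕ → List ℕ → Bool)
    (grew : Bool) (L R S work : List ℕ) : Bool :=
  @List.rec ℕ (fun _ => Bool) (test(grew; k L R; closed K B P T L R S))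
    (fun c work _ => visit K B P T ih grew L R S c work) work

/-- Explore the local configurations reachable with the words `L` and `R`. -/
def sweep (K B P T : ℕ) (k : List ℕ → List ℕ → Bool) (n : ℕ) :
    Bool → List ℕ → List ℕ → List ℕ → List ℕ → Bool :=
  @Nat.rec (fun _ => Bool → List ℕ → List ℕ → List ℕ → List ℕ → Bool)
    (fun _ _ _ _ _ => false) (fun _ ih => sweepS K B P T k ih) n

/-- Look for closed sets of words and local configurations, in at most `n` sweeps. -/
def cps (K B P T n : ℕ) : List ℕ → List ℕ → Bool :=
  @Nat.rec (fun _ => List ℕ → List ℕ → Bool) (fun _ _ => false)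
    (fun _ ih L R => sweep K B P T ih 300 false L R [] [0]) n

/-- Attempt to show that machines with the table `T` do not halt. -/
def nonhalt (T : ℕ) : Bool :=
  test(cps 1 3 1 T 9 [0] [0]; true;
  test(cps 1 3 3 T 9 [0] [0]; true;
  test(cps 1 3 9 T 9 [0] [0]; true;
  test(cps 1 3 27 T 9 [0] [0]; true;
  cps 49 147 147 T 9 [0] [0]))))

/-- The number of nonzero members of a list. -/
def cnt (l : List ℕ) : ℕ :=
  @List.rec ℕ (fun _ => ℕ) 0
    (fun x _ ih => @Nat.rec (fun _ => ℕ) ih (fun _ _ => Nat.succ ih) x) l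

/-- Write `w`, move right and enter `q'`. -/
def mvR (k : ℕ → ℕ → List ℕ → List ℕ → Bool) (l r : List ℕ) (w q' : ℕ) : Bool :=
  @List.rec ℕ (fun _ => Bool) (k q' 0 (w :: l) []) (fun s r _ => k q' s (w :: l) r) r

/-- Write `w`, move left and enter `q'`. -/
def mvL (k : ℕ → ℕ → List ℕ → List ℕ → Bool) (l r : List ℕ) (w q' : ℕ) : Bool :=
  @List.rec ℕ (fun _ => Bool) (k q' 0 [] (w :: r)) (fun s l _ => k q' s l (w :: r)) l

/-- Apply the transition `v` to a tape. -/
def mv (k : ℕ → ℕ → List ℕ → List ℕ → Bool) (v : ℕ) (l r : List ℕ) : Bool :=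
  force (Nat.mod v 2) (force (Nat.div v 4)
    (test(Nat.beq (Nat.mod (Nat.div v 2) 2) 0; mvR k l r; mvL k l r)))

/-- Branch over the transitions at the index `i`, missing in `T`. A halting transition here must
leave at most 9 nonblank cells; if it is the last missing one, the others need no search. -/
def node (ih : ℕ → ℕ → ℕ → List ℕ → List ℕ → Bool) (T : ℕ) (l r : List ℕ) (i : ℕ) : Bool :=
  test(Nat.ble (Nat.add (cnt l) (cnt r)) 8;
    test(allN (fun j => test(Nat.beq j i; true; Nat.ble 1 (look T j))) [0, 1, 2, 3, 4, 5]; true;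
      allN (fun v => force (Nat.add T (Nat.mul (Nat.succ v) (Nat.pow 16 i)))
        (fun T' => mv (ih T') v l r)) [0, 1, 2, 3, 4, 5, 6, 7, 8, 9, 10, 11]); false)

/-- Apply the transition at the index `i`, or branch if it is missing. -/
def explore1 (ih : ℕ → ℕ → ℕ → List ℕ → List ℕ → Bool) (T : ℕ) (l r : List ℕ) (i : ℕ) : Bool :=
  @Nat.rec (fun _ => Bool) (node ih T l r i) (fun v _ => mv (ih T) v l r) (look T i)

/-- One step of the search. -/
def explore0 (ih : ℕ → ℕ → ℕ → List ℕ → List ℕ → Bool) (T q s : ℕ) (l r : List ℕ) : Bool :=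
  force (Nat.add (Nat.mul 3 q) s) (explore1 ih T l r)

/-- Search all completions of the table `T` for `n` steps, then check with `base`. -/
def explore (base : ℕ → ℕ → ℕ → List ℕ → List ℕ → Bool) (n : ℕ) :
    ℕ → ℕ → ℕ → List ℕ → List ℕ → Bool :=
  @Nat.rec (fun _ => ℕ → ℕ → ℕ → List ℕ → List ℕ → Bool) base (fun _ ih => explore0 ih) n

/-! ### Soundness of the list operations -/

theorem force_eq {β : Type} (n : ℕ) (f : ℕ → β) : force n f = f n := rfl

theorem test_eq {β : Type} (b : Bool) (t f : β) :
    @Bool.rec (fun _ => β) f t b = if b = true then t else f := by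
  cases b <;> rfl

theorem test_false_eq_true {b t : Bool} :
    @Bool.rec (fun _ => Bool) false t b = true ↔ b = true ∧ t = true := by
  cases b <;> simp

theorem test_true_eq_true {b f : Bool} :
    @Bool.rec (fun _ => Bool) f true b = true ↔ b = true ∨ f = true := by
  cases b <;> simp

theorem memN_iff {x : ℕ} {l : List ℕ} : memN x l = true ↔ x ∈ l := by
  induction l with
  | nil => simp [memN]
  | cons y l ih =>
    change @Bool.rec (fun _ => Bool) (memN x l) true (Nat.beq x y) = true ↔ _
    rw [test_true_eq_true, ih, Nat.beq_eq, List.mem_cons]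

theorem allN_iff {f : ℕ → Bool} {l : List ℕ} : allN f l = true ↔ ∀ x ∈ l, f x = true := by
  induction l with
  | nil => simp [allN]
  | cons y l ih =>
    change @Bool.rec (fun _ => Bool) false (allN f l) (f y) = true ↔ _
    rw [test_false_eq_true, ih, List.forall_mem_cons]

theorem exts_and_iff {P x : ℕ} {p : ℕ → Bool} {l : List ℕ} :
    exts P x (fun h ih => test(p h; ih; false)) true l = true ↔
      ∀ h ∈ l, h % P = x → p h = true := by
  induction l with
  | nil => simp [exts]
  | cons y l ih =>
    change @Bool.rec (fun _ => Bool) (exts P x _ true l)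
      (@Bool.rec (fun _ => Bool) false (exts P x _ true l) (p y)) (Nat.beq (y % P) x) = true ↔ _
    rw [test_eq, List.forall_mem_cons, ← ih]
    by_cases h : y % P = x
    · rw [if_pos (Nat.beq_eq.mpr h), test_false_eq_true]
      simp [h]
    · rw [if_neg (fun e => h (Nat.beq_eq.mp e))]
      simp [h]

/-! ### Transition tables -/

/-- Every entry defined in the table `T` is the transition of the machine `M`. -/
def Agrees (T : ℕ) (M : Machine 2 3) : Prop :=
  ∀ (q : Fin 2) (a : Fin 3) (v : ℕ), look T (3 * q + a) = v + 1 →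
    ((M q a).1 : ℕ) = v / 4 ∧ (M q a).2.1 = (if v / 2 % 2 = 0 then Dir.R else Dir.L) ∧
      ∃ q' : Fin 2, (M q a).2.2 = some q' ∧ (q' : ℕ) = v % 2

theorem agrees_zero (M : Machine 2 3) : Agrees 0 M := by
  intro q a v h
  change 0 / 16 ^ (3 * (q : ℕ) + a) % 16 = v + 1 at h
  rw [Nat.zero_div, Nat.zero_mod] at h
  omega

theorem look_set {T i j v : ℕ} (hi : i < 6) (hj : j < 6) (hv : v < 12) (h : look T i = 0) :
    look (T + (v + 1) * 16 ^ i) j = if j = i then v + 1 else look T j := by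
  change T / 16 ^ i % 16 = 0 at h
  change (T + (v + 1) * 16 ^ i) / 16 ^ j % 16 = if j = i then v + 1 else T / 16 ^ j % 16
  interval_cases i <;> interval_cases j <;> norm_num at h ⊢ <;> omega

/-- The number describing a transition. -/
def entry (w : Fin 3) (d : Dir) (q : Fin 2) : ℕ :=
  4 * w + 2 * (match d with | Dir.R => 0 | Dir.L => 1) + q

theorem entry_lt (w : Fin 3) (d : Dir) (q : Fin 2) : entry w d q < 12 := by
  cases d <;> simp only [entry] <;> omega

theorem Agrees.set {T : ℕ} {M : Machine 2 3} (hT : Agrees T M) {q : Fin 2} {a : Fin 3}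
    (h : look T (3 * q + a) = 0) {w : Fin 3} {d : Dir} {q' : Fin 2}
    (hM : M q a = (w, d, some q')) :
    Agrees (T + (entry w d q' + 1) * 16 ^ (3 * (q : ℕ) + a)) M := by
  intro p b v hv
  rw [look_set (by omega) (by omega) (entry_lt w d q') h] at hv
  split_ifs at hv with e
  · obtain rfl : p = q := by omega
    obtain rfl : b = a := by omega
    obtain rfl : v = entry w d q' := by omega
    rw [hM]
    refine ⟨?_, ?_, q', rfl, ?_⟩
    · cases d <;> simp only [entry] <;> omega
    · cases d
      · rw [if_neg]
        simp only [entry]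
        omega
      · rw [if_pos]
        simp only [entry]
        omega
    · cases d <;> simp only [entry] <;> omega
  · exact hT p b v hv

theorem step_eq {M : Machine 2 3} {c : Cfg 2 3} {q : Fin 2} (h : c.state = some q) :
    step M c = { state := (M q (c.tape c.pos)).2.2
                 pos := c.pos + (M q (c.tape c.pos)).2.1.move
                 tape := Function.update c.tape c.pos (M q (c.tape c.pos)).1 } := by
  simp only [step, h]

/-! ### Soundness of the nonhalting decider -/

/-- The base `B` number with digits `f 0, …, f (m - 1)`. -/
def enc (B : ℕ) : (ℕ → ℕ) → ℕ → ℕ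
  | _, 0 => 0
  | f, m + 1 => f 0 + B * enc B (fun i => f (i + 1)) m

theorem enc_lt {B : ℕ} : ∀ {f : ℕ → ℕ} (m : ℕ), (∀ i, f i < B) → enc B f m < B ^ m
  | _, 0, _ => by simp [enc]
  | f, m + 1, h => by
    have h1 := enc_lt (f := fun i => f (i + 1)) m (fun i => h _)
    have h2 := h 0
    rw [enc, pow_succ]
    calc f 0 + B * enc B (fun i => f (i + 1)) m
        < B * (enc B (fun i => f (i + 1)) m + 1) := by rw [mul_add]; omega
      _ ≤ B * B ^ m := Nat.mul_le_mul_left _ h1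
      _ = B ^ m * B := mul_comm _ _

theorem enc_succ_right {B : ℕ} : ∀ (f : ℕ → ℕ) (m : ℕ),
    enc B f (m + 1) = enc B f m + B ^ m * f m
  | f, 0 => by simp [enc]
  | f, m + 1 => by
    rw [enc, enc_succ_right, enc]
    ring

theorem enc_succ_mod {B : ℕ} {f : ℕ → ℕ} (m : ℕ) (h : ∀ i, f i < B) :
    enc B f (m + 1) % B ^ m = enc B f m := by
  rw [enc_succ_right, Nat.add_mul_mod_self_left, Nat.mod_eq_of_lt (enc_lt m h)]

theorem enc_zero {B : ℕ} (m : ℕ) : enc B (fun _ => 0) m = 0 := by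
  induction m with
  | zero => rfl
  | succ m ih => rw [enc, ih]; simp

/-- The word of length `m` read from the cell `p` in direction `ε`. -/
def win (B : ℕ) (X : ℤ → ℕ) (ε p : ℤ) (m : ℕ) : ℕ :=
  enc B (fun i => X (p + ε * i)) m

theorem win_lt {B : ℕ} {X : ℤ → ℕ} {ε p : ℤ} (m : ℕ) (h : ∀ i, X i < B) :
    win B X ε p m < B ^ m :=
  enc_lt m (fun _ => h _)

theorem win_succ (B : ℕ) (X : ℤ → ℕ) (ε p : ℤ) (m : ℕ) :
    win B X ε p (m + 1) = X p + B * win B X ε (p + ε) m := by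
  simp only [win, enc]
  congr 2
  · simp
  · congr 1
    funext i
    congr 1
    push_cast
    ring

theorem win_update {B : ℕ} {X : ℤ → ℕ} {ε p : ℤ} (hε : ε * ε = 1) (y : ℕ) (j : ℕ) (m : ℕ) :
    win B (Function.update X p y) ε (p + ε * (j + 1)) m = win B X ε (p + ε * (j + 1)) m := by
  simp only [win]
  congr 1
  funext i
  refine Function.update_of_ne ?_ _ _
  intro h
  have h1 : ε * ((j : ℤ) + 1 + i) = 0 := by linarith
  have h2 : ε * ε * ((j : ℤ) + 1 + i) = 0 := by rw [mul_assoc, h1, mul_zero]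
  rw [hε] at h2
  omega

/-- Every word of length `m` beyond the cell `p` in direction `ε` belongs to `F`. -/
def Covers (B : ℕ) (X : ℤ → ℕ) (ε p : ℤ) (m : ℕ) (F : List ℕ) : Prop :=
  ∀ j : ℕ, win B X ε (p + ε * (j + 1)) m ∈ F

theorem Covers.ahead {B : ℕ} {X : ℤ → ℕ} {ε p : ℤ} {m : ℕ} {F : List ℕ} (hε : ε * ε = 1)
    (h : Covers B X ε p m F) (y : ℕ) : Covers B (Function.update X p y) ε (p + ε) m F := by
  intro j
  have e : p + ε + ε * ((j : ℤ) + 1) = p + ε * (((j + 1 : ℕ) : ℤ) + 1) := by push_cast; ring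
  rw [e, win_update hε]
  exact h (j + 1)

theorem Covers.behind {B : ℕ} {X : ℤ → ℕ} {ε p : ℤ} {m : ℕ} {F : List ℕ} (hε : ε * ε = 1)
    (h : Covers B X ε p (m + 1) F) {y : ℕ} (hy : y + B * win B X ε (p + ε) m ∈ F) :
    Covers B (Function.update X p y) ε (p - ε) (m + 1) F := by
  intro j
  cases j with
  | zero =>
    have e : p - ε + ε * (((0 : ℕ) : ℤ) + 1) = p := by simp
    have e' : p + ε = p + ε * (((0 : ℕ) : ℤ) + 1) := by simp
    rw [e, win_succ, Function.update_self, e', win_update hε, ← e']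
    exact hy
  | succ j =>
    have e : p - ε + ε * (((j + 1 : ℕ) : ℤ) + 1) = p + ε * ((j : ℤ) + 1) := by push_cast; ring
    rw [e, win_update hε]
    exact h j

theorem code_eq (B P l r s q : ℕ) : code B P l r s q = q + 2 * (s + B * (r + P * l)) := rfl

theorem stepK_of_look {K B T : ℕ} {fail : Bool} {right left : ℕ → ℕ → ℕ → Bool}
    {l r s i v : ℕ} (h : look T i = v + 1) :
    stepK K B T fail right left l r s i =
      if v / 2 % 2 = 0 then right (push K B i v s l) r (v % 2)
      else left (push K B i v s r) l (v % 2) := by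
  simp only [stepK, h, test_eq, Nat.beq_eq]
  rfl

theorem stepK_of_look_zero {K B T : ℕ} {fail : Bool} {right left : ℕ → ℕ → ℕ → Bool}
    {l r s i : ℕ} (h : look T i = 0) : stepK K B T fail right left l r s i = fail := by
  simp only [stepK, h]
  rfl

theorem expand_eq {K B P T : ℕ} {fail : Bool} {right left : ℕ → ℕ → ℕ → Bool} (c : ℕ) :
    expand K B P T fail right left c =
      stepK K B T fail right left (c / 2 / B / P) (c / 2 / B % P) (c / 2 % B)
        (3 * (c % 2) + c / 2 % B % 3) := rfl

theorem expand_code {K B P T : ℕ} {fail : Bool} {right left : ℕ → ℕ → ℕ → Bool} {l r s q : ℕ}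
    (hs : s < B) (hr : r < P) (hq : q < 2) :
    expand K B P T fail right left (code B P l r s q) =
      stepK K B T fail right left l r s (3 * q + s % 3) := by
  have h1 : (q + 2 * (s + B * (r + P * l))) % 2 = q := by omega
  have h2 : (q + 2 * (s + B * (r + P * l))) / 2 = s + B * (r + P * l) := by omega
  have h3 : (s + B * (r + P * l)) % B = s := by
    rw [Nat.add_mul_mod_self_left, Nat.mod_eq_of_lt hs]
  have h4 : (s + B * (r + P * l)) / B = r + P * l := by
    rw [Nat.add_mul_div_left _ _ (by omega), Nat.div_eq_of_lt hs, zero_add]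
  have h5 : (r + P * l) % P = r := by rw [Nat.add_mul_mod_self_left, Nat.mod_eq_of_lt hr]
  have h6 : (r + P * l) / P = l := by
    rw [Nat.add_mul_div_left _ _ (by omega), Nat.div_eq_of_lt hr, zero_add]
  rw [expand_eq, code_eq, h1, h2, h3, h4, h5, h6]

theorem closedX_iff {cd : ℕ → ℕ → ℕ → ℕ} {P : ℕ} {L R S : List ℕ} {g x q : ℕ} :
    closedX cd P L R S g x q = true ↔
      g ∈ L ∧ ∀ h ∈ R, h % P = x → cd g q h ∈ S := by
  rw [closedX, test_false_eq_true, memN_iff, exts_and_iff]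
  simp only [force_eq, memF, memN_iff]

theorem closed_iff {K B P T : ℕ} {L R S : List ℕ} :
    closed K B P T L R S = true ↔ 0 ∈ L ∧ 0 ∈ R ∧ 0 ∈ S ∧
      ∀ c ∈ S, expand K B P T false (closedX (codeR B P) P L R S)
        (closedX (codeL B P) P R L S) c = true := by
  rw [closed, test_false_eq_true, test_false_eq_true, test_false_eq_true, allN_iff, memN_iff,
    memN_iff, memN_iff]

/-- The configuration `c` is described by the closed sets `L`, `R`, `S`; the symbols of the
annotated tape `X` carry the actual ones modulo 3. -/
def Described (B m : ℕ) (L R S : List ℕ) (c : Cfg 2 3) : Prop :=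
  ∃ X : ℤ → ℕ, (∀ i, X i < B) ∧ (∀ i, X i % 3 = c.tape i) ∧
    Covers B X 1 c.pos (m + 1) R ∧ Covers B X (-1) c.pos (m + 1) L ∧
    ∃ q : Fin 2, c.state = some q ∧
      code B (B ^ m) (win B X (-1) (c.pos + -1) m) (win B X 1 (c.pos + 1) m) (X c.pos) q ∈ S

theorem described_init {K B m T : ℕ} {L R S : List ℕ} (hB : 0 < B)
    (h : closed K B (B ^ m) T L R S = true) : Described B m L R S (init 2 3) := by
  obtain ⟨hL, hR, hS, -⟩ := closed_iff.mp h
  refine ⟨fun _ => 0, fun _ => hB, fun _ => rfl, fun j => ?_, fun j => ?_, 0, rfl, ?_⟩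
  · rw [win, enc_zero]
    exact hR
  · rw [win, enc_zero]
    exact hL
  · simpa [code_eq, win, enc_zero] using hS

theorem push_eq (K B i v s a : ℕ) :
    push K B i v s a = v / 4 + 3 * ((i + 1 + 7 * (s / 3)) % K) + B * a := rfl

/-- Moving the head of an annotated tape in direction `ε`: the cell left behind extends the known
words on its side, and the words ahead determine the next scanned cell. -/
theorem Covers.move {B m : ℕ} {X : ℤ → ℕ} {ε p : ℤ} {F : List ℕ} (hε : ε * ε = 1)
    (hX : ∀ i, X i < B) (hF : Covers B X ε p (m + 1) F) (y : ℕ) (hy : y < B)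
    {Q : ℕ → ℕ → ℕ → Prop}
    (hQ : ∀ h ∈ F, h % B ^ m = win B X ε (p + ε) m →
      Q ((y + B * win B X (-ε) (p + -ε) m) % B ^ m) (h / B) (h % B)) :
    Q (win B (Function.update X p y) (-ε) (p + ε + -ε) m)
      (win B (Function.update X p y) ε (p + ε + ε) m) (Function.update X p y (p + ε)) := by
  have hε' : -ε * -ε = 1 := by rw [neg_mul_neg, hε]
  have hne : p + ε ≠ p := by
    intro h
    have : ε = 0 := by omega
    simp [this] at hε
  have e0 : ∀ δ : ℤ, p + δ = p + δ * (((0 : ℕ) : ℤ) + 1) := fun δ => by simp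
  have e1 : p + ε + ε = p + ε * (((1 : ℕ) : ℤ) + 1) := by push_cast; ring
  have hh := hF 0
  rw [← e0] at hh
  have key := hQ _ hh (enc_succ_mod m (fun i => hX _))
  have hB : 0 < B := by omega
  rw [win_succ, Nat.add_mul_mod_self_left, Nat.mod_eq_of_lt (hX _),
    Nat.add_mul_div_left _ _ hB, Nat.div_eq_of_lt (hX _), zero_add] at key
  have e2 : (y + B * win B X (-ε) (p + -ε) m) % B ^ m =
      win B (Function.update X p y) (-ε) (p + ε + -ε) m := by
    have hX' : ∀ i, Function.update X p y i < B := by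
      intro i
      by_cases h : i = p
      · rw [h, Function.update_self]
        exact hy
      · rw [Function.update_of_ne h]
        exact hX i
    have : p + ε + -ε = p := by ring
    rw [this]
    have h := enc_succ_mod (B := B) (f := fun i => Function.update X p y (p + -ε * i)) m
      (fun i => hX' _)
    change win B (Function.update X p y) (-ε) p (m + 1) % B ^ m =
      win B (Function.update X p y) (-ε) p m at h
    rw [← h, win_succ, Function.update_self, e0, win_update hε', ← e0]
  rw [← e2, e1, win_update hε, ← e1, Function.update_of_ne hne]
  exact key

theorem described_step {K B m T : ℕ} {L R S : List ℕ} {M : Machine 2 3} (hK : 0 < K)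
    (hB : B = 3 * K) (hT : Agrees T M) (h : closed K B (B ^ m) T L R S = true) {c : Cfg 2 3}
    (hc : Described B m L R S c) : Described B m L R S (step M c) := by
  obtain ⟨-, -, -, hS⟩ := closed_iff.mp h
  obtain ⟨X, hX, hXt, hcR, hcL, q, hq, hmem⟩ := hc
  have hexp := hS _ hmem
  rw [expand_code (hX _) (win_lt m hX) q.isLt, hXt] at hexp
  rcases hv : look T (3 * q + c.tape c.pos) with _ | v
  · rw [stepK_of_look_zero hv] at hexp
    exact absurd hexp (by simp)
  obtain ⟨hw, hd, q', hq', hqv⟩ := hT _ _ _ hv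
  rw [stepK_of_look hv] at hexp
  set i : ℕ := 3 * (q : ℕ) + (c.tape c.pos : ℕ) with hi
  set y : ℕ := v / 4 + 3 * ((i + 1 + 7 * (X c.pos / 3)) % K) with hy
  have hv4 : v / 4 < 3 := by rw [← hw]; exact (M q (c.tape c.pos)).1.isLt
  have hyB : y < B := by
    have := Nat.mod_lt (i + 1 + 7 * (X c.pos / 3)) hK
    omega
  have hX' : ∀ j, Function.update X c.pos y j < B := by
    intro j
    by_cases hj : j = c.pos
    · rw [hj, Function.update_self]
      exact hyB
    · rw [Function.update_of_ne hj]
      exact hX j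
  have hXt' : ∀ j, Function.update X c.pos y j % 3 =
      Function.update c.tape c.pos (M q (c.tape c.pos)).1 j := by
    intro j
    by_cases hj : j = c.pos
    · rw [hj, Function.update_self, Function.update_self, hw]
      omega
    · rw [Function.update_of_ne hj, Function.update_of_ne hj]
      exact hXt j
  rw [step_eq hq]
  by_cases hv2 : v / 2 % 2 = 0
  · rw [if_pos hv2] at hexp hd
    obtain ⟨hg, hh⟩ := closedX_iff.mp hexp
    rw [push_eq] at hg
    refine ⟨Function.update X c.pos y, hX', hXt', ?_, ?_, q', hq', ?_⟩
    · simp only [hd]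
      exact hcR.ahead (by norm_num) y
    · simp only [hd]
      exact hcL.behind (by norm_num) hg
    · simp only [hd]
      refine Covers.move (ε := 1) (F := R) (Q := fun a b s => code B (B ^ m) a b s q' ∈ S)
        (by norm_num) hX hcR y hyB ?_
      intro h h1 h2
      rw [hqv]
      exact hh h h1 h2
  · rw [if_neg hv2] at hexp hd
    obtain ⟨hg, hh⟩ := closedX_iff.mp hexp
    rw [push_eq] at hg
    refine ⟨Function.update X c.pos y, hX', hXt', ?_, ?_, q', hq', ?_⟩
    · simp only [hd]
      have := hcR.behind (by norm_num) hg
      exact this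
    · simp only [hd]
      exact hcL.ahead (by norm_num) y
    · simp only [hd]
      refine Covers.move (ε := -1) (F := L) (Q := fun a b s => code B (B ^ m) b a s q' ∈ S)
        (by norm_num) hX hcL y hyB ?_
      intro h h1 h2
      rw [hqv]
      exact hh h h1 h2

/-- `M` does not halt from the blank tape. -/
def Loops (M : Machine 2 3) : Prop :=
  ∀ t, ((step M)^[t] (init 2 3)).state ≠ none

theorem loops_of_closed {K B m T : ℕ} {L R S : List ℕ} {M : Machine 2 3} (hK : 0 < K)
    (hB : B = 3 * K) (hT : Agrees T M) (h : closed K B (B ^ m) T L R S = true) : Loops M := by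
  have key : ∀ t, Described B m L R S ((step M)^[t] (init 2 3)) := by
    intro t
    induction t with
    | zero => exact described_init (by omega) h
    | succ t ih =>
      rw [Function.iterate_succ_apply']
      exact described_step hK hB hT h ih
  intro t ht
  obtain ⟨X, -, -, -, -, q, hq, -⟩ := key t
  simp [ht] at hq

theorem expand_cases {K B P T : ℕ} {fail : Bool} {right left : ℕ → ℕ → ℕ → Bool} (c : ℕ) :
    expand K B P T fail right left c = fail ∨
      (∃ g x q, expand K B P T fail right left c = right g x q) ∨
      ∃ g x q, expand K B P T fail right left c = left g x q := by
  rw [expand_eq]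
  rcases hv : look T (3 * (c % 2) + c / 2 % B % 3) with _ | v
  · exact Or.inl (stepK_of_look_zero hv)
  · rw [stepK_of_look hv]
    split_ifs
    · exact Or.inr (Or.inl ⟨_, _, _, rfl⟩)
    · exact Or.inr (Or.inr ⟨_, _, _, rfl⟩)

theorem add1_cases {cd : ℕ → ℕ → ℕ → ℕ} {P : ℕ} {L R : List ℕ}
    {k : Bool → List ℕ → List ℕ → Bool} {grew : Bool} {work : List ℕ} {g x q : ℕ}
    (h : add1 cd P L R k grew work g x q = true) : ∃ b l w, k b l w = true := by
  rw [add1] at h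
  cases hm : memN g L
  · rw [hm] at h
    exact ⟨_, _, _, h⟩
  · rw [hm] at h
    exact ⟨_, _, _, h⟩

/-- Some sets of words and local configurations pass the final check. -/
def HasClosed (K B P T : ℕ) : Prop :=
  ∃ L R S, closed K B P T L R S = true

theorem sweep_sound {K B P T : ℕ} {k : List ℕ → List ℕ → Bool}
    (hk : ∀ L R, k L R = true → HasClosed K B P T) (n : ℕ) :
    ∀ grew L R S work, sweep K B P T k n grew L R S work = true → HasClosed K B P T := by
  induction n with
  | zero =>
    intro grew L R S work h
    exact absurd h Bool.false_ne_true
  | succ n ih =>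
    intro grew L R S work h
    change sweepS K B P T k (sweep K B P T k n) grew L R S work = true at h
    cases work with
    | nil =>
      cases grew with
      | false => exact ⟨L, R, S, h⟩
      | true => exact hk _ _ h
    | cons c work =>
      change visit K B P T (sweep K B P T k n) grew L R S c work = true at h
      rw [visit, test_eq] at h
      split_ifs at h
      · exact ih _ _ _ _ _ h
      · rcases expand_cases (K := K) (B := B) (P := P) (T := T) (fail := false)
            (right := add1 (codeR B P) P L R (kR (sweep K B P T k n) R (c :: S)) grew work)
            (left := add1 (codeL B P) P R L (kL (sweep K B P T k n) L (c :: S)) grew work) c with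
          e | ⟨g, x, q, e⟩ | ⟨g, x, q, e⟩
        · rw [e] at h
          exact absurd h Bool.false_ne_true
        · rw [e] at h
          obtain ⟨b, l, w, h'⟩ := add1_cases h
          exact ih _ _ _ _ _ h'
        · rw [e] at h
          obtain ⟨b, l, w, h'⟩ := add1_cases h
          exact ih _ _ _ _ _ h'

theorem cps_sound {K B P T : ℕ} (n : ℕ) :
    ∀ L R, cps K B P T n L R = true → HasClosed K B P T := by
  induction n with
  | zero =>
    intro L R h
    exact absurd h Bool.false_ne_true
  | succ n ih =>
    intro L R h
    exact sweep_sound ih 300 false L R [] [0] h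

theorem loops_of_cps {K B P T n : ℕ} {M : Machine 2 3} {L R : List ℕ} (m : ℕ) (hK : 0 < K)
    (hB : B = 3 * K) (hP : P = B ^ m) (hT : Agrees T M) (h : cps K B P T n L R = true) :
    Loops M := by
  obtain ⟨L', R', S', h'⟩ := cps_sound n L R h
  rw [hP] at h'
  exact loops_of_closed hK hB hT h'

theorem loops_of_nonhalt {T : ℕ} {M : Machine 2 3} (hT : Agrees T M) (h : nonhalt T = true) :
    Loops M := by
  rw [nonhalt, test_true_eq_true, test_true_eq_true, test_true_eq_true, test_true_eq_true] at h
  rcases h with h | h | h | h | h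
  · exact loops_of_cps 0 (by norm_num) (by norm_num) (by norm_num) hT h
  · exact loops_of_cps 1 (by norm_num) (by norm_num) (by norm_num) hT h
  · exact loops_of_cps 2 (by norm_num) (by norm_num) (by norm_num) hT h
  · exact loops_of_cps 3 (by norm_num) (by norm_num) (by norm_num) hT h
  · exact loops_of_cps 1 (by norm_num) (by norm_num) (by norm_num) hT h

/-! ### Soundness of the search -/

/-- `M` takes at most `N` steps and leaves at most 9 nonblank cells if it halts. -/
def Bounded (M : Machine 2 3) (N : ℕ) : Prop :=
  ∀ t, HaltsIn M (init 2 3) t → t ≤ N ∧ sigmaCount ((step M)^[t] (init 2 3)) ≤ 9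

theorem Loops.bounded {M : Machine 2 3} (h : Loops M) (N : ℕ) : Bounded M N :=
  fun t ht => absurd ht.1 (h t)

/-- The configuration `c` is in state `q`, scans the symbol `s`, and `l`, `r` list the cells on
both sides of the head, nearest first. -/
structure Matches (c : Cfg 2 3) (q s : ℕ) (l r : List ℕ) : Prop where
  state : ∃ p : Fin 2, c.state = some p ∧ (p : ℕ) = q
  scan : (c.tape c.pos : ℕ) = s
  left : ∀ i : ℕ, (c.tape (c.pos - 1 - i) : ℕ) = l.getD i 0
  right : ∀ i : ℕ, (c.tape (c.pos + 1 + i) : ℕ) = r.getD i 0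

theorem matches_init : Matches (init 2 3) 0 0 [] [] where
  state := ⟨0, rfl, rfl⟩
  scan := rfl
  left _ := rfl
  right _ := rfl

/-- The effect of a move on the description of a configuration. -/
def mvResult (v : ℕ) (l r : List ℕ) : ℕ × ℕ × List ℕ × List ℕ :=
  if v / 2 % 2 = 0 then (v % 2, r.headD 0, v / 4 :: l, r.tail)
  else (v % 2, l.headD 0, l.tail, v / 4 :: r)

theorem mv_eq (k : ℕ → ℕ → List ℕ → List ℕ → Bool) (v : ℕ) (l r : List ℕ) :
    mv k v l r = k (mvResult v l r).1 (mvResult v l r).2.1 (mvResult v l r).2.2.1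
      (mvResult v l r).2.2.2 := by
  have hmv : mv k v l r = if Nat.beq (v / 2 % 2) 0 = true then mvR k l r (v / 4) (v % 2)
      else mvL k l r (v / 4) (v % 2) := by
    rw [mv, force_eq, force_eq, test_eq]
    split_ifs with h h' h' <;> first | rfl | exact absurd h h' | exact absurd h' h
  rw [hmv, mvResult]
  by_cases h : v / 2 % 2 = 0
  · rw [if_pos h, if_pos (Nat.beq_eq.mpr h)]
    cases r <;> rfl
  · rw [if_neg h, if_neg (fun e => h (Nat.beq_eq.mp e))]
    cases l <;> rfl

theorem headD_eq_getD (l : List ℕ) : l.headD 0 = l.getD 0 0 := by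
  cases l <;> rfl

theorem getD_tail (l : List ℕ) (i : ℕ) : l.tail.getD i 0 = l.getD (i + 1) 0 := by
  cases l <;> simp

theorem Matches.next {M : Machine 2 3} {T q s v : ℕ} {l r : List ℕ} {c : Cfg 2 3}
    (hT : Agrees T M) (hc : Matches c q s l r) (hv : look T (3 * q + s) = v + 1) :
    Matches (step M c) (mvResult v l r).1 (mvResult v l r).2.1 (mvResult v l r).2.2.1
      (mvResult v l r).2.2.2 := by
  obtain ⟨⟨p, hp, rfl⟩, rfl, hl, hr⟩ := hc
  obtain ⟨hw, hd, q', hq', hqv⟩ := hT _ _ _ hv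
  rw [step_eq hp, mvResult]
  by_cases h : v / 2 % 2 = 0
  · rw [if_pos h] at hd ⊢
    refine ⟨⟨q', hq', hqv⟩, ?_, fun i => ?_, fun i => ?_⟩ <;> simp only [hd, Dir.move]
    · rw [Function.update_of_ne (by omega), headD_eq_getD, ← hr 0]
      simp
    · cases i with
      | zero => simp [hw]
      | succ i =>
        rw [Function.update_of_ne (by push_cast; omega), List.getD_cons_succ, ← hl i]
        congr 2
        push_cast
        ring
    · rw [Function.update_of_ne (by omega), getD_tail, ← hr (i + 1)]
      congr 2
      push_cast
      ring
  · rw [if_neg h] at hd ⊢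
    refine ⟨⟨q', hq', hqv⟩, ?_, fun i => ?_, fun i => ?_⟩ <;> simp only [hd, Dir.move]
    · rw [Function.update_of_ne (by omega), headD_eq_getD, ← hl 0]
      simp [sub_eq_add_neg]
    · rw [Function.update_of_ne (by omega), getD_tail, ← hl (i + 1)]
      congr 2
      push_cast
      ring
    · cases i with
      | zero => simp [hw]
      | succ i =>
        rw [Function.update_of_ne (by push_cast; omega), List.getD_cons_succ, ← hr i]
        congr 2
        push_cast
        ring

theorem cnt_cons_zero (l : List ℕ) : cnt (0 :: l) = cnt l := rfl

theorem cnt_cons_succ (x : ℕ) (l : List ℕ) : cnt ((x + 1) :: l) = cnt l + 1 := rfl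

theorem support_getD (l : List ℕ) :
    ∃ F : Finset ℕ, F.card ≤ cnt l ∧ ∀ i, l.getD i 0 ≠ 0 → i ∈ F := by
  induction l with
  | nil => exact ⟨∅, le_rfl, fun i h => absurd rfl h⟩
  | cons x l ih =>
    obtain ⟨F, hF, hmem⟩ := ih
    cases x with
    | zero =>
      refine ⟨F.image Nat.succ, (Finset.card_image_le).trans hF, fun i hi => ?_⟩
      cases i with
      | zero => exact absurd rfl hi
      | succ i => exact Finset.mem_image_of_mem _ (hmem i hi)
    | succ x =>
      refine ⟨insert 0 (F.image Nat.succ), ?_, fun i hi => ?_⟩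
      · rw [cnt_cons_succ]
        exact (Finset.card_insert_le _ _).trans
          (Nat.succ_le_succ ((Finset.card_image_le).trans hF))
      · cases i with
        | zero => exact Finset.mem_insert_self _ _
        | succ i => exact Finset.mem_insert_of_mem (Finset.mem_image_of_mem _ (hmem i hi))

theorem int_cases (p i : ℤ) :
    i = p ∨ (∃ n : ℕ, i = p - 1 - n) ∨ ∃ n : ℕ, i = p + 1 + n := by
  rcases lt_trichotomy i p with h | h | h
  · exact Or.inr (Or.inl ⟨(p - 1 - i).toNat, by omega⟩)
  · exact Or.inl h
  · exact Or.inr (Or.inr ⟨(i - p - 1).toNat, by omega⟩)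

theorem Matches.sigmaCount_step_le {M : Machine 2 3} {q s : ℕ} {l r : List ℕ} {c : Cfg 2 3}
    (hc : Matches c q s l r) : sigmaCount (step M c) ≤ 1 + (cnt l + cnt r) := by
  obtain ⟨⟨p, hp, rfl⟩, rfl, hl, hr⟩ := hc
  obtain ⟨F, hF, hFm⟩ := support_getD l
  obtain ⟨G, hG, hGm⟩ := support_getD r
  have hsub : {i : ℤ | (step M c).tape i ≠ 0} ⊆
      ↑({c.pos} ∪ (F.image (fun n : ℕ => c.pos - 1 - (n : ℤ)) ∪
        G.image (fun n : ℕ => c.pos + 1 + (n : ℤ))) : Finset ℤ) := by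
    intro i hi
    rw [Set.mem_ofPred_eq, step_eq hp] at hi
    simp only at hi
    rw [Finset.mem_coe, Finset.mem_union, Finset.mem_union, Finset.mem_singleton]
    rcases int_cases c.pos i with h | ⟨n, h⟩ | ⟨n, h⟩
    · exact Or.inl h
    · right; left
      rw [Function.update_of_ne (by omega), h] at hi
      exact Finset.mem_image.mpr ⟨n, hFm n (by rw [← hl]; exact fun e => hi (Fin.ext e)), h.symm⟩
    · right; right
      rw [Function.update_of_ne (by omega), h] at hi
      exact Finset.mem_image.mpr ⟨n, hGm n (by rw [← hr]; exact fun e => hi (Fin.ext e)), h.symm⟩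
  refine (Set.ncard_le_ncard hsub (Finset.finite_toSet _)).trans ?_
  rw [Set.ncard_coe_finset]
  refine (Finset.card_union_le _ _).trans (Nat.add_le_add (by simp) ?_)
  exact (Finset.card_union_le _ _).trans
    (Nat.add_le_add (Finset.card_image_le.trans hF) (Finset.card_image_le.trans hG))

theorem state_none_of_le {M : Machine 2 3} {c : Cfg 2 3} {t u : ℕ} (h : t ≤ u)
    (ht : ((step M)^[t] c).state = none) : ((step M)^[u] c).state = none := by
  induction u, h using Nat.le_induction with
  | base => exact ht
  | succ u _ ih =>
    rw [Function.iterate_succ_apply']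
    simp only [step, ih]

theorem haltsIn_eq {M : Machine 2 3} {c : Cfg 2 3} {t k : ℕ} (ht : HaltsIn M c t)
    (h1 : ((step M)^[k] c).state ≠ none) (h2 : ((step M)^[k + 1] c).state = none) :
    t = k + 1 := by
  have h3 : ¬ t ≤ k := fun h => h1 (state_none_of_le h ht.1)
  have h4 : ¬ k + 1 < t := fun h => ht.2 _ h h2
  omega

theorem bounded_of_halt {M : Machine 2 3} {N k q s : ℕ} {l r : List ℕ} {p : Fin 2} {a : Fin 3}
    (hc : Matches ((step M)^[k] (init 2 3)) q s l r) (hp : (p : ℕ) = q) (ha : (a : ℕ) = s)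
    (hM : (M p a).2.2 = none) (hk : k + 1 ≤ N) (hcnt : cnt l + cnt r ≤ 8) : Bounded M N := by
  intro t ht
  obtain ⟨p', hp', h1⟩ := hc.state
  obtain rfl : p' = p := by omega
  obtain rfl : ((step M)^[k] (init 2 3)).tape ((step M)^[k] (init 2 3)).pos = a := by
    have := hc.scan
    omega
  have h2 : ((step M)^[k + 1] (init 2 3)).state = none := by
    rw [Function.iterate_succ_apply', step_eq hp']
    exact hM
  obtain rfl := haltsIn_eq ht (by simp [hp']) h2
  refine ⟨hk, ?_⟩
  rw [Function.iterate_succ_apply']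
  exact hc.sigmaCount_step_le.trans (by omega)

theorem loops_of_forall {M : Machine 2 3} (h : ∀ q a, (M q a).2.2 ≠ none) : Loops M := by
  intro t
  induction t with
  | zero => simp [init]
  | succ t ih =>
    obtain ⟨q, hq⟩ := Option.ne_none_iff_exists'.mp ih
    rw [Function.iterate_succ_apply', step_eq hq]
    exact h _ _

theorem node_iff {ih : ℕ → ℕ → ℕ → List ℕ → List ℕ → Bool} {T i : ℕ} {l r : List ℕ} :
    node ih T l r i = true ↔ cnt l + cnt r ≤ 8 ∧
      ((∀ j ∈ [0, 1, 2, 3, 4, 5], j = i ∨ 1 ≤ look T j) ∨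
        ∀ v ∈ [0, 1, 2, 3, 4, 5, 6, 7, 8, 9, 10, 11],
          mv (ih (T + (v + 1) * 16 ^ i)) v l r = true) := by
  rw [node, test_false_eq_true, test_true_eq_true, allN_iff, allN_iff]
  refine and_congr (iff_of_eq Nat.ble_eq) (or_congr ?_ Iff.rfl)
  refine forall₂_congr fun j _ => ?_
  rw [test_true_eq_true, Nat.beq_eq, Nat.ble_eq]

theorem explore_sound {M : Machine 2 3} {base : ℕ → ℕ → ℕ → List ℕ → List ℕ → Bool}
    (hbase : ∀ T q s l r, Agrees T M → base T q s l r = true → Loops M) (n : ℕ) :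
    ∀ {N k T q s : ℕ} {l r : List ℕ}, k + n = N → Agrees T M →
      Matches ((step M)^[k] (init 2 3)) q s l r → explore base n T q s l r = true →
      Bounded M N := by
  induction n with
  | zero =>
    intro N k T q s l r _ hT _ h
    exact (hbase T q s l r hT h).bounded N
  | succ n ih =>
    intro N k T q s l r hN hT hc h
    change explore1 (explore base n) T l r (3 * q + s) = true at h
    obtain ⟨p, hp, hpq⟩ := hc.state
    obtain ⟨a, ha⟩ : ∃ a : Fin 3, (a : ℕ) = s := ⟨_, hc.scan⟩
    have advance : ∀ {T' v : ℕ}, Agrees T' M → look T' (3 * q + s) = v + 1 →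
        mv (explore base n T') v l r = true → Bounded M N := by
      intro T' v hT' hv h'
      rw [mv_eq] at h'
      have hc' := hc.next hT' hv
      rw [← Function.iterate_succ_apply' (step M)] at hc'
      exact ih (by omega) hT' hc' h'
    rcases hv : look T (3 * q + s) with _ | v
    · simp only [explore1, hv] at h
      obtain ⟨hcnt, hrest⟩ := node_iff.mp h
      rcases hM : M p a with ⟨w, d, _ | q'⟩
      · exact bounded_of_halt hc hpq ha (by rw [hM]) (by omega) hcnt
      rcases hrest with hall | hall
      · refine (loops_of_forall fun p' a' => ?_).bounded N
        rcases hall (3 * p' + a') (by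
          have h1 := p'.isLt
          have h2 := a'.isLt
          simp only [List.mem_cons, List.not_mem_nil]
          omega) with e | e
        · obtain rfl : p' = p := by omega
          obtain rfl : a' = a := by omega
          simp [hM]
        · obtain ⟨u, hu⟩ := Nat.exists_eq_add_of_le' e
          obtain ⟨-, -, q'', h1, -⟩ := hT _ _ _ hu
          simp [h1]
      · subst hpq ha
        refine advance (hT.set hv hM) ?_ (hall (entry w d q') ?_)
        · rw [look_set (by omega) (by omega) (entry_lt w d q') hv, if_pos rfl]
        · have := entry_lt w d q'
          simp only [List.mem_cons, List.not_mem_nil]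
          omega
    · simp only [explore1, hv] at h
      exact advance hT hv h

/-- The search over all completions of the table `T`, deciding by `nonhalt` after `n` steps. -/
def search (n T q s : ℕ) (l r : List ℕ) : Bool :=
  explore (fun T _ _ _ _ => nonhalt T) n T q s l r

theorem bounded_of_search {M : Machine 2 3} {N T : ℕ} (hT : Agrees T M)
    (h : search N T 0 0 [] [] = true) : Bounded M N :=
  explore_sound (fun _ _ _ _ _ => loops_of_nonhalt) N (zero_add N) hT matches_init h

/-! ### Symmetries -/

/-- The configuration `c'` is the image of `c` under a renaming `f` of the symbols and a
reflection `ε` of the tape. -/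
structure Related (f : Fin 3 → Fin 3) (ε : ℤ) (c c' : Cfg 2 3) : Prop where
  state : c'.state = c.state
  pos : c'.pos = ε * c.pos
  tape : ∀ i, c'.tape (ε * i) = f (c.tape i)

section Symmetry

variable {f : Fin 3 → Fin 3} {g : Dir → Dir} {ε : ℤ} {M : Machine 2 3}

/-- The image of a machine under a renaming of the symbols and a change of directions. -/
def conj (f : Fin 3 → Fin 3) (g : Dir → Dir) (M : Machine 2 3) : Machine 2 3 :=
  fun q a => (f (M q (f a)).1, g (M q (f a)).2.1, (M q (f a)).2.2)

theorem Related.step (hf : ∀ a, f (f a) = a) (hε : ε * ε = 1)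
    (hg : ∀ d, (g d).move = ε * d.move) {c c' : Cfg 2 3} (h : Related f ε c c') :
    Related f ε (step M c) (step (conj f g M) c') := by
  rcases hq : c.state with _ | q
  · have hq' := h.state.trans hq
    simp only [_root_.step, hq, hq']
    exact h
  · have hq' := h.state.trans hq
    have hs : f (c'.tape c'.pos) = c.tape c.pos := by rw [h.pos, h.tape, hf]
    rw [step_eq hq, step_eq hq']
    refine ⟨?_, ?_, fun i => ?_⟩ <;> simp only [conj, hs]
    · rw [hg, h.pos]
      ring
    · by_cases hi : i = c.pos
      · rw [hi, ← h.pos, Function.update_self, Function.update_self]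
      · rw [Function.update_of_ne hi, Function.update_of_ne, h.tape]
        intro e
        rw [h.pos] at e
        apply hi
        have : ε * (ε * i) = ε * (ε * c.pos) := by rw [e]
        rwa [← mul_assoc, ← mul_assoc, hε, one_mul, one_mul] at this

theorem related_iterate (hf : ∀ a, f (f a) = a) (hf0 : f 0 = 0) (hε : ε * ε = 1)
    (hg : ∀ d, (g d).move = ε * d.move) (t : ℕ) :
    Related f ε ((_root_.step M)^[t] (init 2 3)) ((_root_.step (conj f g M))^[t] (init 2 3)) := by
  induction t with
  | zero => exact ⟨rfl, by simp [init], fun i => by simp [init, hf0]⟩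
  | succ t ih =>
    rw [Function.iterate_succ_apply', Function.iterate_succ_apply']
    exact ih.step hf hε hg

theorem Related.sigmaCount_eq (hf : ∀ a, f (f a) = a) (hf0 : f 0 = 0) (hε : ε * ε = 1)
    {c c' : Cfg 2 3} (h : Related f ε c c') : sigmaCount c' = sigmaCount c := by
  have hinv : ∀ i, ε * (ε * i) = i := fun i => by rw [← mul_assoc, hε, one_mul]
  have hset : {i : ℤ | c'.tape i ≠ 0} = (fun i => ε * i) '' {i : ℤ | c.tape i ≠ 0} := by
    ext i
    simp only [Set.mem_image, Set.mem_ofPred_eq]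
    constructor
    · intro hi
      refine ⟨ε * i, fun e => hi ?_, hinv i⟩
      rw [← hinv i, h.tape, e, hf0]
    · rintro ⟨j, hj, rfl⟩ e
      rw [h.tape] at e
      exact hj (by rw [← hf (c.tape j), e, hf0])
  rw [sigmaCount, hset, Set.ncard_image_of_injective _ (Function.LeftInverse.injective hinv)]
  rfl

theorem Bounded.of_conj (hf : ∀ a, f (f a) = a) (hf0 : f 0 = 0) (hε : ε * ε = 1)
    (hg : ∀ d, (g d).move = ε * d.move) {N : ℕ} (h : Bounded (conj f g M) N) : Bounded M N := by
  intro t ht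
  have key := related_iterate (M := M) hf hf0 hε hg
  have := h t ⟨(key t).state.trans ht.1, fun i hi => by
    rw [(key i).state]
    exact ht.2 i hi⟩
  rwa [(key t).sigmaCount_eq hf hf0 hε] at this

end Symmetry

/-! ### The upper bounds -/

theorem search_keep_zero_left (v : ℕ) (hv : v < 2) : search 38 (v + 1) 0 0 [] [] = true := by
  interval_cases v <;> decide +kernel

theorem search_write_one_stay : search 38 5 0 0 [] [] = true := by
  decide +kernel

theorem search_write_one_move_aux (v : ℕ) (hv : v < 12) :
    mv (search 36 (6 + (v + 1) * 16 ^ 3)) v [1] [] = true := by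
  interval_cases v <;> decide +kernel

theorem search_write_one_move : search 38 6 0 0 [] [] = true := by
  change node (search 36) 6 [1] [] 3 = true
  refine node_iff.mpr ⟨by decide, Or.inr fun v hv => search_write_one_move_aux v ?_⟩
  fin_cases hv <;> norm_num

theorem bounded_of_normal {M : Machine 2 3} {w : Fin 3} {q : Fin 2}
    (hM : M 0 0 = (w, Dir.R, some q)) (hw : w ≠ 2) : Bounded M 38 := by
  have hT : Agrees (0 + (entry w Dir.R q + 1) * 16 ^ 0) M :=
    (agrees_zero M).set (q := 0) (a := 0) rfl hM
  have hs : search 38 (0 + (entry w Dir.R q + 1) * 16 ^ 0) 0 0 [] [] = true := by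
    rw [zero_add, pow_zero, mul_one]
    fin_cases w <;> fin_cases q
    · exact search_keep_zero_left 0 (by norm_num)
    · exact search_keep_zero_left 1 (by norm_num)
    · exact search_write_one_stay
    · exact search_write_one_move
    · exact absurd rfl hw
    · exact absurd rfl hw
  exact bounded_of_search hT hs

/-- The reflection of a direction. -/
def reflect : Dir → Dir
  | Dir.L => Dir.R
  | Dir.R => Dir.L

theorem bounded_of_right {M : Machine 2 3} {w : Fin 3} {q : Fin 2}
    (hM : M 0 0 = (w, Dir.R, some q)) : Bounded M 38 := by
  by_cases hw : w = 2
  · subst hw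
    refine Bounded.of_conj (f := ![0, 2, 1]) (g := id) (ε := 1) (by decide) rfl (by norm_num)
      (fun d => (one_mul _).symm) (bounded_of_normal (w := 1) (q := q) ?_ (by decide))
    change (_, _, _) = _
    rw [show (![0, 2, 1] : Fin 3 → Fin 3) 0 = 0 from rfl, hM]
    rfl
  · exact bounded_of_normal hM hw

theorem bounded (M : Machine 2 3) : Bounded M 38 := by
  rcases hM : M 0 0 with ⟨w, d, _ | q⟩
  · exact bounded_of_halt (k := 0) matches_init (p := 0) (a := 0) rfl rfl (by rw [hM])
      (by norm_num) (by decide)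
  · cases d with
    | R => exact bounded_of_right hM
    | L =>
      refine Bounded.of_conj (f := id) (g := reflect) (ε := -1) (fun _ => rfl) rfl (by norm_num)
        (fun d => by cases d <;> rfl) (bounded_of_right (w := w) (q := q) ?_)
      change (_, _, _) = _
      simp only [id_eq, hM, reflect]

/-! ### The champion -/

/-- A machine attaining both maxima. -/
def champion : Machine 2 3 :=
  ![![(1, Dir.R, some 1), (2, Dir.L, some 1), (1, Dir.R, none)],
    ![(2, Dir.L, some 0), (2, Dir.R, some 1), (1, Dir.L, some 1)]]

theorem champion_valid : Valid champion := by
  intro q a h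
  fin_cases q <;> fin_cases a <;> simp_all [champion]

/-- The transition table of the champion. -/
def championTable : ℕ :=
  6 + 12 * 16 + 11 * 16 ^ 3 + 10 * 16 ^ 4 + 8 * 16 ^ 5

theorem agrees_champion : Agrees championTable champion := by
  have h := (((((agrees_zero champion).set (q := 0) (a := 0) rfl rfl).set
    (q := 0) (a := 1) rfl rfl).set (q := 1) (a := 0) rfl rfl).set
    (q := 1) (a := 1) rfl rfl).set (q := 1) (a := 2) rfl rfl
  exact h

/-- The description of the configuration after `n` steps following the table `T`. -/
def run (T n : ℕ) : ℕ × ℕ × List ℕ × List ℕ :=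
  Nat.rec (0, 0, [], []) (fun _ c => mvResult (look T (3 * c.1 + c.2.1) - 1) c.2.2.1 c.2.2.2) n

theorem matches_run {M : Machine 2 3} {T : ℕ} (hT : Agrees T M) (n : ℕ)
    (h : ∀ m < n, look T (3 * (run T m).1 + (run T m).2.1) ≠ 0) :
    Matches ((step M)^[n] (init 2 3)) (run T n).1 (run T n).2.1 (run T n).2.2.1
      (run T n).2.2.2 := by
  induction n with
  | zero => exact matches_init
  | succ n ih =>
    rw [Function.iterate_succ_apply']
    exact (ih fun m hm => h m (by omega)).next hT
      (Nat.succ_pred_eq_of_pos (Nat.pos_of_ne_zero (h n (by omega)))).symm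

theorem matches_champion (n : ℕ) (h : n ≤ 37) :
    Matches ((step champion)^[n] (init 2 3)) (run championTable n).1 (run championTable n).2.1
      (run championTable n).2.2.1 (run championTable n).2.2.2 := by
  refine matches_run agrees_champion n fun m hm => ?_
  have key : ∀ m < 37, look championTable
    (3 * (run championTable m).1 + (run championTable m).2.1) ≠ 0 := by decide +kernel
  exact key m (by omega)

theorem champion_haltsIn : HaltsIn champion (init 2 3) 38 := by
  constructor
  · rw [Function.iterate_succ_apply']
    obtain ⟨⟨p, hp, hpq⟩, hs, -, -⟩ := matches_champion 37 le_rfl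
    rw [show (run championTable 37).1 = 0 by decide +kernel] at hpq
    rw [show (run championTable 37).2.1 = 2 by decide +kernel] at hs
    rw [step_eq hp, show p = 0 from Fin.ext hpq, Fin.ext (b := (2 : Fin 3)) hs]
    rfl
  · intro i hi
    obtain ⟨p, hp, -⟩ := (matches_champion i (by omega)).state
    simp [hp]

theorem champion_sigmaCount : sigmaCount ((step champion)^[38] (init 2 3)) = 9 := by
  rw [Function.iterate_succ_apply']
  have hc := matches_champion 37 le_rfl
  rw [show run championTable 37 = (0, 2, [2, 2, 2, 2, 2, 2, 2], [2]) by decide +kernel] at hc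
  obtain ⟨⟨p, hp, hpq⟩, hs, hl, hr⟩ := hc
  generalize (step champion)^[37] (init 2 3) = c at hp hs hl hr
  obtain rfl : p = 0 := Fin.ext hpq
  have hs' : c.tape c.pos = 2 := Fin.ext hs
  have hset : {i : ℤ | (step champion c).tape i ≠ 0} =
      ↑(Finset.Icc (c.pos - 7) (c.pos + 1)) := by
    ext i
    rw [Set.mem_ofPred_eq, Finset.coe_Icc, Set.mem_Icc, step_eq hp, hs', ne_eq, Fin.ext_iff]
    simp only
    rcases int_cases c.pos i with h | ⟨n, h⟩ | ⟨n, h⟩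
    · rw [h, Function.update_self]
      simp [champion]
    · rw [Function.update_of_ne (by omega), h, hl]
      rcases lt_or_ge n 7 with hn | hn
      · interval_cases n <;> simp <;> omega
      · rw [List.getD_eq_default _ _ (by simpa using hn)]
        simp
        omega
    · rw [Function.update_of_ne (by omega), h, hr]
      rcases lt_or_ge n 1 with hn | hn
      · interval_cases n
        simp
        omega
      · rw [List.getD_eq_default _ _ (by simpa using hn)]
        simp
        omega
  rw [sigmaCount, hset, Set.ncard_coe_finset, Int.card_Icc]
  omega

end BusyBeaver

/-- Every 2-state 3-symbol machine that halts from the all-blank tape takes at most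
38 steps and leaves at most 9 non-blank cells; both bounds are attained.
That is, `S(2,3) = 38` and `Σ(2,3) = 9`. -/
theorem busy_beaver_values_2_3 :
    (∀ M : Machine 2 3, Valid M → ∀ t : ℕ, HaltsIn M (init 2 3) t →
        t ≤ 38 ∧ sigmaCount ((step M)^[t] (init 2 3)) ≤ 9) ∧
    (∃ M : Machine 2 3, Valid M ∧ HaltsIn M (init 2 3) 38) ∧
    (∃ M : Machine 2 3, Valid M ∧ ∃ t : ℕ, HaltsIn M (init 2 3) t ∧
        sigmaCount ((step M)^[t] (init 2 3)) = 9) ∧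
    bbS 2 3 = 38 ∧ bbSigma 2 3 = 9 := by
  have upper : ∀ M : Machine 2 3, Valid M → ∀ t : ℕ, HaltsIn M (init 2 3) t →
      t ≤ 38 ∧ sigmaCount ((step M)^[t] (init 2 3)) ≤ 9 := fun M _ => BusyBeaver.bounded M
  have steps : ∃ M : Machine 2 3, Valid M ∧ HaltsIn M (init 2 3) 38 :=
    ⟨BusyBeaver.champion, BusyBeaver.champion_valid, BusyBeaver.champion_haltsIn⟩
  have score : ∃ M : Machine 2 3, Valid M ∧ ∃ t : ℕ, HaltsIn M (init 2 3) t ∧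
      sigmaCount ((step M)^[t] (init 2 3)) = 9 :=
    ⟨BusyBeaver.champion, BusyBeaver.champion_valid, 38, BusyBeaver.champion_haltsIn,
      BusyBeaver.champion_sigmaCount⟩
  refine ⟨upper, steps, score, ?_, ?_⟩
  · refine IsGreatest.csSup_eq ⟨steps, ?_⟩
    rintro t ⟨M, hM, ht⟩
    exact (upper M hM t ht).1
  · refine IsGreatest.csSup_eq ⟨score, ?_⟩
    rintro m ⟨M, hM, t, ht, rfl⟩
    exact (upper M hM t ht).2
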